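/- Let C_0 ≥ 0. Suppose the hyperplanes in 𝒜 are pairwise non-parallel and ‖F(A)‖ > C_0 for every A ∈ 𝒜. Then for every k with 1 ≤ k ≤ n, w_k(B_k) ≤ (1/((1−δ_k)|S_k|)) · ∑_{J ⊆ {1,…,k−1}, ‖J‖ > C_0/|S_k|} ν(J) = (1/((1−δ_k)|S_k|)) · ∑_{J ⊆ {1,…,k−1}, ‖J‖ > C_0/|S_k|} ∏_{j∈J} 1/((1−δ_j)|S_j|). -/

import Mathlib

open Finset
open scoped Classical

/-- A hyperplane in `S_1 × ⋯ × S_n`.  Coordinates are 0-indexed in Lean: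
coordinate `j : ℕ`, `j < n`, corresponds to the paper's coordinate `j + 1`,
so the paper's set `S_j` is `S (j - 1)` here.  A hyperplane is recorded by its
finite set `F` of fixed coordinates together with the fixed value at each
fixed coordinate (on the non-fixed coordinates it is all of `S j`). -/
structure Hyp (S : ℕ → Type) (n : ℕ) where
  F : Finset ℕ
  hF : ∀ j ∈ F, j < n
  val : ∀ j ∈ F, S j

/-- The stage of a hyperplane: in the paper's 1-based labelling,
`A.stage = max F(A)`; in the 0-based labelling it is `(sup of A.F) + 1`. -/
def Hyp.stage {S : ℕ → Type} {n : ℕ} (A : Hyp S n) : ℕ := A.F.sup id + 1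

/-- `Qp S k` is the paper's `Q_k = S_1 × ⋯ × S_k` (in 0-based indexing,
`S 0 × ⋯ × S (k-1)`).  `Qp S 0` is a one-element type. -/
abbrev Qp (S : ℕ → Type) (k : ℕ) := ∀ j : Fin k, S j

/-- `x ∈ Q_k` lies on (the projection to `Q_k` of) the hyperplane `A`;
this is the correct notion of membership whenever `F(A) ⊆ {1, …, k}`. -/
def memH {S : ℕ → Type} {n : ℕ} (A : Hyp S n) {k : ℕ} (x : Qp S k) : Prop :=
  ∀ (j : Fin k) (h : (j : ℕ) ∈ A.F), x j = A.val j h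

/-- Membership in `B_k = ⋃_{A ∈ 𝒜_k} A`, viewed as a subset of `Q_k`, where
`𝒜_k = {A ∈ 𝒜 : max F(A) = k}` (1-based `k`). -/
def memB {S : ℕ → Type} {n : ℕ} {ι : Type} (𝓐 : ι → Hyp S n) (k : ℕ) (x : Qp S k) : Prop :=
  ∃ i, (𝓐 i).stage = k ∧ memH (𝓐 i) x

/-- `alpha 𝓐 k x` is the paper's `α_{k+1}(x)` for `x ∈ Q_k`: the proportion of
the fiber `F_x` covered by `B_{k+1}`. -/
noncomputable def alpha {S : ℕ → Type} [∀ j, Fintype (S j)] {n : ℕ} {ι : Type}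
    (𝓐 : ι → Hyp S n) (k : ℕ) (x : Qp S k) : ℝ :=
  ((univ.filter fun y : S k => memB 𝓐 (k + 1) (Fin.snoc x y)).card : ℝ) /
    (Fintype.card (S k))

/-- The weights `w_k : Q_k → ℝ`, defined inductively:  `w_0 ≡ 1`, and `w_(k+1)`
is obtained from `w_k` by the distortion rule with parameter `δ_{k+1} = δ k`.
(The paper's `δ_j` is `δ (j - 1)` here.) -/
noncomputable def w {S : ℕ → Type} [∀ j, Fintype (S j)] {n : ℕ} {ι : Type}
    (𝓐 : ι → Hyp S n) (δ : ℕ → ℝ) : (k : ℕ) → Qp S k → ℝ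
  | 0, _ => 1
  | (k + 1), x =>
      let x' : Qp S k := fun j => x j.castSucc
      let a : ℝ := alpha 𝓐 k x'
      if memB 𝓐 (k + 1) x then
        if a ≤ δ k then 0
        else ((a - δ k) / (a * (1 - δ k))) * (w 𝓐 δ k x' / (Fintype.card (S k)))
      else
        if a ≤ δ k then (1 / (1 - a)) * (w 𝓐 δ k x' / (Fintype.card (S k)))
        else (1 / (1 - δ k)) * (w 𝓐 δ k x' / (Fintype.card (S k)))

/-- `w_k(B_k)` (1-based `k`). -/
noncomputable def wB {S : ℕ → Type} [∀ j, Fintype (S j)] {n : ℕ} {ι : Type}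
    (𝓐 : ι → Hyp S n) (δ : ℕ → ℝ) (k : ℕ) : ℝ :=
  ∑ x ∈ univ.filter (memB 𝓐 k), w 𝓐 δ k x

/-- `w_k(A)`: the weight of the projection to `Q_k` of a hyperplane `A`
(meaningful when `F(A) ⊆ {1, …, k}`). -/
noncomputable def wH {S : ℕ → Type} [∀ j, Fintype (S j)] {n : ℕ} {ι : Type}
    (𝓐 : ι → Hyp S n) (δ : ℕ → ℝ) (k : ℕ) (A : Hyp S n) : ℝ :=
  ∑ x ∈ univ.filter (fun x : Qp S k => memH A x), w 𝓐 δ k x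

/-- `ν(J) = ∏_{j ∈ J} 1 / ((1 - δ_j)|S_j|)` (0-based `J`). -/
noncomputable def nu (S : ℕ → Type) [∀ j, Fintype (S j)] (δ : ℕ → ℝ) (J : Finset ℕ) : ℝ :=
  ∏ j ∈ J, 1 / ((1 - δ j) * (Fintype.card (S j)))

/-- `‖J‖ = ∏_{j ∈ J} |S_j|` (0-based `J`). -/
noncomputable def normJ (S : ℕ → Type) [∀ j, Fintype (S j)] (J : Finset ℕ) : ℝ :=
  ∏ j ∈ J, (Fintype.card (S j) : ℝ)

/-- `Ew 𝓐 δ k` is the paper's `E_k = E_{(k+1)-1} = ∑_{x ∈ Q_k} α_{k+1}(x)² w_k(x)`. -/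
noncomputable def Ew {S : ℕ → Type} [∀ j, Fintype (S j)] {n : ℕ} {ι : Type}
    (𝓐 : ι → Hyp S n) (δ : ℕ → ℝ) (k : ℕ) : ℝ :=
  ∑ x : Qp S k, (alpha 𝓐 k x) ^ 2 * w 𝓐 δ k x

section Aux

variable {S : ℕ → Type} {n : ℕ}

theorem sum_Qp_succ [∀ j, Fintype (S j)] {k : ℕ} (f : Qp S (k + 1) → ℝ) :
    ∑ x, f x = ∑ x : Qp S k, ∑ y : S k, f (Fin.snoc x y) := by
  rw [← (Fin.snocEquiv fun j : Fin (k + 1) => S j).sum_comp, Fintype.sum_prod_type_right]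
  rfl

theorem memH_snoc (A : Hyp S n) {k : ℕ} (x : Qp S k) (y : S k) :
    memH A (Fin.snoc x y : Qp S (k + 1)) ↔ memH A x ∧ ∀ h : k ∈ A.F, y = A.val k h := by
  simp only [memH, Fin.forall_fin_succ', Fin.snoc_castSucc, Fin.snoc_last]
  rfl

theorem Hyp.lt_stage {A : Hyp S n} {j : ℕ} (hj : j ∈ A.F) : j < A.stage :=
  Nat.lt_succ_of_le (le_sup (f := id) hj)

theorem Hyp.mem_of_stage_eq {A : Hyp S n} (hA : A.F.Nonempty) {k : ℕ} (h : A.stage = k + 1) :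
    k ∈ A.F := by
  obtain ⟨j, hj, hj'⟩ := exists_mem_eq_sup A.F hA id
  have : A.F.sup id = k := Nat.succ_injective h
  rw [this] at hj'
  exact hj' ▸ hj

variable [∀ j, Fintype (S j)] {ι : Type} (𝓐 : ι → Hyp S n) (δ : ℕ → ℝ)

theorem w_snoc {k : ℕ} (x : Qp S k) (y : S k) :
    w 𝓐 δ (k + 1) (Fin.snoc x y) =
      (if memB 𝓐 (k + 1) (Fin.snoc x y : Qp S (k + 1)) then
        if alpha 𝓐 k x ≤ δ k then 0
        else (alpha 𝓐 k x - δ k) / (alpha 𝓐 k x * (1 - δ k))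
      else
        if alpha 𝓐 k x ≤ δ k then 1 / (1 - alpha 𝓐 k x)
        else 1 / (1 - δ k)) * (w 𝓐 δ k x / Fintype.card (S k)) := by
  simp only [w, Fin.snoc_castSucc]
  split_ifs <;> simp

theorem alpha_nonneg {k : ℕ} (x : Qp S k) : 0 ≤ alpha 𝓐 k x := by
  unfold alpha; positivity

variable {δ}

theorem w_nonneg {k : ℕ} (hδ : ∀ j < k, δ j ∈ Set.Icc (0 : ℝ) (1 / 2)) (x : Qp S k) :
    0 ≤ w 𝓐 δ k x := by
  induction k with
  | zero => simp [w]
  | succ k ih =>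
    obtain ⟨x, y, rfl⟩ : ∃ (x' : Qp S k) (y : S k), x = Fin.snoc x' y :=
      ⟨Fin.init x, x (Fin.last k), (Fin.snoc_init_self x).symm⟩
    have hx := ih (fun j hj => hδ j (by lia)) x
    obtain ⟨h0, h1⟩ := hδ k (by lia)
    have ha := alpha_nonneg 𝓐 x
    rw [w_snoc]
    refine mul_nonneg ?_ (by positivity)
    split_ifs with _ h h
    · exact le_rfl
    · exact div_nonneg (by linarith) (mul_nonneg ha (by linarith))
    · exact div_nonneg zero_le_one (by linarith)
    · exact div_nonneg zero_le_one (by linarith)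

theorem w_snoc_le {k : ℕ} (hδ : ∀ j < k + 1, δ j ∈ Set.Icc (0 : ℝ) (1 / 2))
    (x : Qp S k) (y : S k) :
    w 𝓐 δ (k + 1) (Fin.snoc x y) ≤
      1 / ((1 - δ k) * Fintype.card (S k)) * w 𝓐 δ k x := by
  have hx := w_nonneg 𝓐 (fun j hj => hδ j (by lia)) x
  obtain ⟨h0, h1⟩ := hδ k (by lia)
  have ha := alpha_nonneg 𝓐 x
  have hp : 0 < 1 - δ k := by linarith
  rw [w_snoc, show 1 / ((1 - δ k) * (Fintype.card (S k) : ℝ)) * w 𝓐 δ k x =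
    1 / (1 - δ k) * (w 𝓐 δ k x / Fintype.card (S k)) by
    rw [div_mul_div_comm, one_mul, one_div_mul_eq_div]]
  refine mul_le_mul_of_nonneg_right ?_ (by positivity)
  split_ifs with _ h h
  · positivity
  · have ha' : 0 < alpha 𝓐 k x := by linarith
    rw [div_le_div_iff₀ (by positivity) hp]
    nlinarith
  · exact one_div_le_one_div_of_le hp (by linarith)
  · exact le_rfl

theorem sum_w_snoc {k : ℕ} (hk : 0 < Fintype.card (S k)) (hδ : δ k ∈ Set.Icc (0 : ℝ) (1 / 2))
    (x : Qp S k) : ∑ y : S k, w 𝓐 δ (k + 1) (Fin.snoc x y) = w 𝓐 δ k x := by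
  obtain ⟨h0, h1⟩ := hδ
  have hp : 1 - δ k ≠ 0 := by linarith
  have hc : (Fintype.card (S k) : ℝ) ≠ 0 := by positivity
  have hB : ((univ.filter fun y : S k => memB 𝓐 (k + 1) (Fin.snoc x y : Qp S (k + 1))).card : ℝ) =
      alpha 𝓐 k x * Fintype.card (S k) := by
    unfold alpha; field_simp
  have hBc : ((univ.filter fun y : S k => ¬ memB 𝓐 (k + 1) (Fin.snoc x y : Qp S (k + 1))).card : ℝ)
      = (1 - alpha 𝓐 k x) * Fintype.card (S k) := by
    have h := card_filter_add_card_filter_not (s := (univ : Finset (S k)))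
      (fun y => memB 𝓐 (k + 1) (Fin.snoc x y : Qp S (k + 1)))
    rw [card_univ] at h
    have h' : (_ : ℝ) = _ := congrArg (Nat.cast : ℕ → ℝ) h
    push_cast at h'
    linarith
  simp only [w_snoc, ← sum_mul]
  rw [sum_ite]
  simp only [sum_const, nsmul_eq_mul, hB, hBc]
  split_ifs with h
  · have : 1 - alpha 𝓐 k x ≠ 0 := by linarith
    field_simp
    ring
  · have : alpha 𝓐 k x ≠ 0 := by linarith
    field_simp
    ring

theorem wH_le_nu_inter {k : ℕ} (hcard : ∀ j < k, 0 < Fintype.card (S j))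
    (hδ : ∀ j < k, δ j ∈ Set.Icc (0 : ℝ) (1 / 2)) (A : Hyp S n) :
    wH 𝓐 δ k A ≤ nu S δ (A.F.filter (· < k)) := by
  induction k with
  | zero => simp [wH, nu, memH, w]
  | succ k ih =>
    have ih := ih (fun j hj => hcard j (by lia)) (fun j hj => hδ j (by lia))
    unfold wH at ih ⊢
    rw [sum_filter] at ih ⊢
    rw [sum_Qp_succ]
    simp only [memH_snoc, ite_and]
    by_cases hkF : k ∈ A.F
    · have hF : A.F.filter (· < k + 1) = insert k (A.F.filter (· < k)) := by
        ext j; simp only [mem_filter, mem_insert]; grind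
      have hp : 0 ≤ 1 / ((1 - δ k) * Fintype.card (S k)) := by
        have := (hδ k (by lia)).2
        exact div_nonneg zero_le_one (mul_nonneg (by linarith) (by positivity))
      rw [hF, nu, prod_insert (by simp)]
      refine le_trans ?_ (mul_le_mul_of_nonneg_left ih hp)
      rw [mul_sum]
      refine sum_le_sum fun x _ => ?_
      split_ifs
      · simpa [hkF] using w_snoc_le 𝓐 hδ x (A.val k hkF)
      · simp
    · have hF : A.F.filter (· < k + 1) = A.F.filter (· < k) := by
        ext j; simp only [mem_filter]; grind
      rw [hF]
      refine le_trans (sum_le_sum fun x _ => ?_) ih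
      split_ifs
      · simpa [hkF] using (sum_w_snoc 𝓐 (hcard k (by lia)) (hδ k (by lia)) x).le
      · simp

theorem wB_le_sum_wH [Fintype ι] {k : ℕ} (hδ : ∀ j < k, δ j ∈ Set.Icc (0 : ℝ) (1 / 2)) :
    wB 𝓐 δ k ≤ ∑ i with (𝓐 i).stage = k, wH 𝓐 δ k (𝓐 i) := by
  simp only [wB, wH, sum_filter (p := fun x => memH _ x)]
  rw [sum_comm, sum_filter]
  refine sum_le_sum fun x _ => ?_
  have hterm : ∀ i, 0 ≤ if memH (𝓐 i) x then w 𝓐 δ k x else 0 := fun i => by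
    split_ifs
    exacts [w_nonneg 𝓐 hδ x, le_rfl]
  split_ifs with h
  · obtain ⟨i, hi, hx⟩ := h
    refine le_trans ?_ (single_le_sum (fun i _ => hterm i)
      (mem_filter.2 ⟨mem_univ i, hi⟩))
    rw [if_pos hx]
  · exact sum_nonneg fun i _ => hterm i

end Aux

/-- **Corollary 1.**  Let `C₀ ≥ 0`.  If the hyperplanes of `𝒜` are pairwise
non-parallel and `‖F(A)‖ > C₀` for every `A ∈ 𝒜`, then for `1 ≤ k ≤ n`
(the paper's `k` is `k + 1` here, `k < n`):
`w_k(B_k) ≤ (1 / ((1 - δ_k)|S_k|)) ∑_{J ⊆ {1,…,k-1}, ‖J‖ > C₀/|S_k|} ν(J)`. -/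
theorem wB_le_sum_over_subsets
    (S : ℕ → Type) [∀ j, Fintype (S j)] (n : ℕ) (hn : 0 < n)
    (hcard : ∀ j, j < n → 2 ≤ Fintype.card (S j))
    (δ : ℕ → ℝ) (hδ : ∀ j, j < n → δ j ∈ Set.Icc (0 : ℝ) (1 / 2))
    (ι : Type) [Fintype ι] (𝓐 : ι → Hyp S n)
    (hFne : ∀ i, (𝓐 i).F.Nonempty)
    (hpar : ∀ i i', (𝓐 i).F = (𝓐 i').F → i = i')
    (C₀ : ℝ) (hC₀ : 0 ≤ C₀)
    (hnorm : ∀ i, C₀ < normJ S (𝓐 i).F)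
    (k : ℕ) (hk : k < n) :
    wB 𝓐 δ (k + 1) ≤ (1 / ((1 - δ k) * (Fintype.card (S k)))) *
      ∑ J ∈ (Finset.range k).powerset.filter
          (fun J => C₀ / (Fintype.card (S k)) < normJ S J),
        ∏ j ∈ J, 1 / ((1 - δ j) * (Fintype.card (S j))) := by
  have hδk : ∀ j < k + 1, δ j ∈ Set.Icc (0 : ℝ) (1 / 2) := fun j hj => hδ j (by lia)
  have hck : ∀ j < k + 1, 0 < Fintype.card (S j) := fun j hj =>
    two_pos.trans_le (hcard j (by lia))
  have hfac : ∀ j < k + 1, 0 ≤ 1 / ((1 - δ j) * (Fintype.card (S j) : ℝ)) := fun j hj =>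
    div_nonneg zero_le_one (mul_nonneg (by linarith [(hδk j hj).2]) (Nat.cast_nonneg _))
  have hmem : ∀ i, (𝓐 i).stage = k + 1 → k ∈ (𝓐 i).F := fun i hi =>
    Hyp.mem_of_stage_eq (hFne i) hi
  calc wB 𝓐 δ (k + 1)
      ≤ ∑ i with (𝓐 i).stage = k + 1, wH 𝓐 δ (k + 1) (𝓐 i) := wB_le_sum_wH 𝓐 hδk
    _ ≤ ∑ i with (𝓐 i).stage = k + 1,
          1 / ((1 - δ k) * (Fintype.card (S k) : ℝ)) * nu S δ ((𝓐 i).F.erase k) := by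
        refine sum_le_sum fun i hi => ?_
        have hi := (mem_filter.1 hi).2
        refine (wH_le_nu_inter 𝓐 hck hδk (𝓐 i)).trans_eq ?_
        rw [filter_true_of_mem fun j hj => (Hyp.lt_stage hj).trans_eq hi]
        exact (mul_prod_erase _ _ (hmem i hi)).symm
    _ = 1 / ((1 - δ k) * (Fintype.card (S k) : ℝ)) *
          ∑ J ∈ (univ.filter fun i => (𝓐 i).stage = k + 1).image fun i => (𝓐 i).F.erase k,
            nu S δ J := by
        rw [← mul_sum, sum_image]
        intro i hi i' hi' h
        refine hpar i i' ?_
        rw [← insert_erase (hmem i (by simpa using hi)),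
          ← insert_erase (hmem i' (by simpa using hi'))]
        exact congrArg (insert k) h
    _ ≤ _ := by
        refine mul_le_mul_of_nonneg_left ?_ (hfac k (by lia))
        refine sum_le_sum_of_subset_of_nonneg (fun J hJ => ?_) fun J hJ _ => ?_
        · obtain ⟨i, hi, rfl⟩ := mem_image.1 hJ
          have hi := (mem_filter.1 hi).2
          rw [mem_filter, mem_powerset, div_lt_iff₀' (Nat.cast_pos.2 (hck k (by lia)))]
          refine ⟨fun j hj => ?_, ?_⟩
          · obtain ⟨hjk, hj⟩ := mem_erase.1 hj
            have := Hyp.lt_stage hj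
            rw [mem_range]
            lia
          · refine (hnorm i).trans_eq ?_
            exact (mul_prod_erase _ _ (hmem i hi)).symm
        · have hJ := mem_powerset.1 (mem_filter.1 hJ).1
          refine prod_nonneg fun j hj => hfac j ?_
          have := mem_range.1 (hJ hj)
          lia
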